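/- Let G be a finite group, N a normal subgroup, F a perfect splitting field of characteristic 2. Every nontrivial self-dual irreducible FG-module is of quadratic type if and only if every nontrivial self-dual irreducible FN-module is of quadratic type and every nontrivial self-dual irreducible F(G/N)-module is of quadratic type. -/

import Mathlib

open Module

section Defs
variable {F : Type} [Field F] {G : Type} [Group G]
variable {V W : Type} [AddCommGroup V] [Module F V] [AddCommGroup W] [Module F W]

def IsSubrep (ρ : Representation F G V) (U : Submodule F V) : Prop :=
  ∀ (g : G), ∀ v ∈ U, ρ g v ∈ U

def IsIrred (ρ : Representation F G V) : Prop :=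
  Nontrivial V ∧ ∀ U : Submodule F V, IsSubrep ρ U → U = ⊥ ∨ U = ⊤

def RepIso (ρ : Representation F G V) (σ : Representation F G W) : Prop :=
  ∃ e : V ≃ₗ[F] W, ∀ (g : G) (v : V), e (ρ g v) = σ g (e v)

def IsSelfDual (ρ : Representation F G V) : Prop :=
  RepIso ρ ρ.dual

def IsTrivialRep (ρ : Representation F G V) : Prop := ∀ (g : G) (v : V), ρ g v = v

def EquivHom (σ : Representation F G W) (ρ : Representation F G V) :
    Submodule F (W →ₗ[F] V) where
  carrier := {f | ∀ (g : G) (w : W), f (σ g w) = ρ g (f w)}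
  add_mem' := by
    intro f f' hf hf' g w
    simp [LinearMap.add_apply, hf g w, hf' g w]
  zero_mem' := by intro g w; simp
  smul_mem' := by
    intro c f hf g w
    simp [LinearMap.smul_apply, hf g w]

noncomputable def repMult (σ : Representation F G W) (ρ : Representation F G V) : ℕ :=
  Module.finrank F (EquivHom σ ρ)

def BilinInvariant (ρ : Representation F G V) (B : V →ₗ[F] V →ₗ[F] F) : Prop :=
  ∀ (g : G) (v w : V), B (ρ g v) (ρ g w) = B v w

def Nondeg (B : V →ₗ[F] V →ₗ[F] F) : Prop := ∀ v : V, (∀ w : V, B v w = 0) → v = 0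

def IsAltForm (B : V →ₗ[F] V →ₗ[F] F) : Prop := ∀ v : V, B v v = 0

def PolarizesTo (Q : V → F) (B : V →ₗ[F] V →ₗ[F] F) : Prop :=
  (∀ (a : F) (v : V), Q (a • v) = a ^ 2 * Q v) ∧
    ∀ v w : V, Q (v + w) = Q v + B v w + Q w

def QuadInvariant (ρ : Representation F G V) (Q : V → F) : Prop :=
  ∀ (g : G) (v : V), Q (ρ g v) = Q v

def HasQuadType (ρ : Representation F G V) : Prop :=
  ∃ (Q : V → F) (B : V →ₗ[F] V →ₗ[F] F),
    PolarizesTo Q B ∧ QuadInvariant ρ Q ∧ Nondeg B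

def IsSplitting (F G : Type) [Field F] [Group G] : Prop :=
  ∀ (V : Type) [AddCommGroup V] [Module F V] (ρ : Representation F G V),
    FiniteDimensional F V → IsIrred ρ →
      ∀ f ∈ EquivHom ρ ρ, ∃ c : F, f = c • (LinearMap.id : V →ₗ[F] V)

structure RepOn (F G : Type) [Field F] [Group G] where
  carrier : Type
  [ag : AddCommGroup carrier]
  [md : Module F carrier]
  rep : Representation F G carrier

attribute [instance] RepOn.ag RepOn.md

end Defs


/-- Every nontrivial self-dual irreducible FX-module is of quadratic type. -/
def AllQuadType (F X : Type) [Field F] [Group X] : Prop :=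
  ∀ (V : Type) [AddCommGroup V] [Module F V] (ρ : Representation F X V),
    FiniteDimensional F V → IsIrred ρ → ¬ IsTrivialRep ρ → IsSelfDual ρ → HasQuadType ρ

section General
variable {F : Type} [Field F] {X : Type} [Group X]
variable {V : Type} [AddCommGroup V] [Module F V]

/-- The restriction of a representation to an invariant submodule. -/
def subRep (ρ : Representation F X V) (U : Submodule F V) (hU : IsSubrep ρ U) :
    Representation F X U where
  toFun g := (ρ g).restrict (hU g)
  map_one' := by ext; simp
  map_mul' g h := by ext; simp [LinearMap.restrict_apply]

@[simp] lemma subRep_apply_coe (ρ : Representation F X V) (U : Submodule F V)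
    (hU : IsSubrep ρ U) (g : X) (u : U) : (subRep ρ U hU g u : V) = ρ g u := rfl

lemma exists_form_of_isSelfDual {ρ : Representation F X V} (h : IsSelfDual ρ) :
    ∃ B : V →ₗ[F] V →ₗ[F] F, BilinInvariant ρ B ∧ Nondeg B := by
  obtain ⟨e, he⟩ := h
  refine ⟨e.toLinearMap, fun g v w => ?_, fun v hv => ?_⟩
  · have := LinearMap.congr_fun (he g v) (ρ g w)
    simpa [Representation.dual_apply, Module.Dual.transpose_apply] using this
  · exact e.map_eq_zero_iff.mp (LinearMap.ext hv)

lemma Nondeg.bijective [FiniteDimensional F V] {B : V →ₗ[F] V →ₗ[F] F} (h : Nondeg B) :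
    Function.Bijective B := by
  have hi : Function.Injective B := by
    rw [injective_iff_map_eq_zero]
    exact fun v hv => h v fun w => by rw [hv]; rfl
  exact ⟨hi, (LinearMap.injective_iff_surjective_of_finrank_eq_finrank
    Subspace.dual_finrank_eq.symm).mp hi⟩

lemma isSelfDual_of_form [FiniteDimensional F V] {ρ : Representation F X V}
    {B : V →ₗ[F] V →ₗ[F] F} (hB : BilinInvariant ρ B) (h : Nondeg B) : IsSelfDual ρ := by
  refine ⟨LinearEquiv.ofBijective B h.bijective, fun g v => LinearMap.ext fun w => ?_⟩
  simpa [Representation.dual_apply, Module.Dual.transpose_apply] using hB g v (ρ g⁻¹ w)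

/-- On an irreducible representation a nonzero invariant bilinear form is nondegenerate. -/
lemma nondeg_of_ne_zero {ρ : Representation F X V} (hρ : IsIrred ρ)
    {B : V →ₗ[F] V →ₗ[F] F} (hB : BilinInvariant ρ B) (h : B ≠ 0) : Nondeg B := by
  rcases hρ.2 (LinearMap.ker B) (fun g v hv => by
    rw [LinearMap.mem_ker] at hv ⊢
    ext w
    simpa [hv] using hB g v (ρ g⁻¹ w)) with hk | hk
  · intro v hv
    have : v ∈ LinearMap.ker B := LinearMap.mem_ker.mpr (LinearMap.ext hv)
    simpa [hk] using this
  · exact absurd (LinearMap.ker_eq_top.mp hk) h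

/-- Schur's lemma for invariant bilinear forms. -/
lemma exists_smul_form [FiniteDimensional F V] (hs : IsSplitting F X)
    {ρ : Representation F X V} (hρ : IsIrred ρ) {B C : V →ₗ[F] V →ₗ[F] F}
    (hB : BilinInvariant ρ B) (hn : Nondeg B) (hC : BilinInvariant ρ C) :
    ∃ c : F, C = c • B := by
  let e := LinearEquiv.ofBijective B hn.bijective
  have he : ∀ v w, B (e.symm (C v)) w = C v w := fun v w =>
    LinearMap.congr_fun (e.apply_symm_apply (C v)) w
  obtain ⟨c, hc⟩ := hs V ρ inferInstance hρ (e.symm.toLinearMap ∘ₗ C) (fun g v => by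
    apply hn.bijective.1
    ext w
    have h1 := he (ρ g v) w
    have h2 := hB g (e.symm (C v)) (ρ g⁻¹ w)
    have h3 := hC g v (ρ g⁻¹ w)
    simp only [Representation.self_inv_apply] at h2 h3
    simp only [LinearMap.comp_apply, LinearEquiv.coe_coe]
    rw [h1, h2, h3, he])
  refine ⟨c, LinearMap.ext fun v => LinearMap.ext fun w => ?_⟩
  have := LinearMap.congr_fun hc v
  simp only [LinearMap.comp_apply, LinearEquiv.coe_coe, LinearMap.smul_apply,
    LinearMap.id_apply] at this
  rw [← he, this]
  simp

lemma PolarizesTo.smul {Q : V → F} {B : V →ₗ[F] V →ₗ[F] F} (h : PolarizesTo Q B) (c : F) :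
    PolarizesTo (fun v => c * Q v) (c • B) := by
  refine ⟨fun a v => ?_, fun v w => ?_⟩
  · dsimp only
    rw [h.1]; ring
  · dsimp only
    rw [h.2]; simp; ring

lemma PolarizesTo.bilinInvariant {ρ : Representation F X V} {Q : V → F}
    {B : V →ₗ[F] V →ₗ[F] F} (h : PolarizesTo Q B) (hQ : QuadInvariant ρ Q) :
    BilinInvariant ρ B := by
  intro g v w
  have h1 := h.2 (ρ g v) (ρ g w)
  rw [← map_add, hQ, hQ, hQ, h.2] at h1
  linear_combination -h1

lemma IsSplitting.of_mulEquiv {Y : Type} [Group Y] (e : Y ≃* X) (h : IsSplitting F Y) :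
    IsSplitting F X := by
  intro V _ _ ρ hfd hρ f hf
  refine h V (ρ.comp e.toMonoidHom) hfd ⟨hρ.1, fun U hU => hρ.2 U fun g v hv => ?_⟩ f
    fun g v => hf (e g) v
  simpa using hU (e.symm g) v hv

lemma BilinInvariant.flip_eq [CharP F 2] [FiniteDimensional F V] (hs : IsSplitting F X)
    {ρ : Representation F X V} (hρ : IsIrred ρ) {B : V →ₗ[F] V →ₗ[F] F}
    (hB : BilinInvariant ρ B) (hn : Nondeg B) (v w : V) : B v w = B w v := by
  obtain ⟨c, hc⟩ := exists_smul_form hs hρ hB hn (C := B.flip) (fun g v w => hB g w v)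
  have h1 : ∀ v w, B w v = c * B v w := fun v w => by
    simpa using LinearMap.congr_fun (LinearMap.congr_fun hc v) w
  by_cases h0 : B v w = 0
  · rw [h1 v w, h0, mul_zero]
  · have h2 : (c - 1) ^ 2 = 0 := by
      have h3 : c ^ 2 = 1 := by
        apply mul_right_cancel₀ h0
        linear_combination -(h1 w v) - c * h1 v w
      rw [sub_pow_char, h3]; simp
    have h4 : c = 1 := by simpa [sub_eq_zero] using h2
    rw [h1 v w, h4, one_mul]

/-- An additive function that is semilinear for the squaring map on a perfect field of
characteristic two is the square of a linear functional. -/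
lemma exists_linear_sq_eq [CharP F 2] [PerfectField F] (D : V → F)
    (hadd : ∀ v w, D (v + w) = D v + D w) (hsmul : ∀ (a : F) v, D (a • v) = a ^ 2 * D v) :
    ∃ l : V →ₗ[F] F, ∀ v, l v ^ 2 = D v := by
  have : Fact (Nat.Prime 2) := ⟨Nat.prime_two⟩
  have : PerfectRing F 2 := PerfectField.toPerfectRing 2
  refine ⟨{ toFun := fun v => (frobeniusEquiv F 2).symm (D v)
            map_add' := fun v w => by rw [hadd, map_add]
            map_smul' := fun a v => ?_ }, fun v => frobeniusEquiv_symm_pow_p F 2 _⟩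
  rw [hsmul, map_mul]
  congr 1
  exact frobeniusEquiv_symm_apply_frobenius F 2 a

lemma exists_sq_eq [CharP F 2] [PerfectField F] (a : F) : ∃ b : F, b ^ 2 = a := by
  have : Fact (Nat.Prime 2) := ⟨Nat.prime_two⟩
  have : PerfectRing F 2 := PerfectField.toPerfectRing 2
  exact ⟨_, frobeniusEquiv_symm_pow_p F 2 a⟩

end General

section Extension
variable {F : Type} [Field F] {N : Type} [Group N]
variable {V : Type} [AddCommGroup V] [Module F V]

/-- On the invariant submodule `U`, the function `Q` is an invariant quadratic form with
polar form `B`. -/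
structure IsQuadOn (ρ : Representation F N V) (B : V →ₗ[F] V →ₗ[F] F) (U : Submodule F V)
    (Q : V → F) : Prop where
  subrep : IsSubrep ρ U
  smul : ∀ (a : F), ∀ v ∈ U, Q (a • v) = a ^ 2 * Q v
  add : ∀ v ∈ U, ∀ w ∈ U, Q (v + w) = Q v + B v w + Q w
  inv : ∀ n, ∀ v ∈ U, Q (ρ n v) = Q v

lemma IsQuadOn.exists_sup {ρ : Representation F N V} {B : V →ₗ[F] V →ₗ[F] F}
    (hB : BilinInvariant ρ B) (hsym : ∀ v w, B v w = B w v)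
    {M S : Submodule F V} (hd : Disjoint M S) {P R : V → F}
    (hP : IsQuadOn ρ B M P) (hR : IsQuadOn ρ B S R) : ∃ Q, IsQuadOn ρ B (M ⊔ S) Q := by
  have hex : ∀ v, ∃ m s, v ∈ M ⊔ S → m ∈ M ∧ s ∈ S ∧ m + s = v := fun v => by
    by_cases h : v ∈ M ⊔ S
    · obtain ⟨m, hm, s, hs, e⟩ := Submodule.mem_sup.mp h
      exact ⟨m, s, fun _ => ⟨hm, hs, e⟩⟩
    · exact ⟨0, 0, fun h' => absurd h' h⟩
  choose p r hpr using hex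
  have key : ∀ m ∈ M, ∀ s ∈ S, p (m + s) = m ∧ r (m + s) = s := by
    intro m hm s hs
    obtain ⟨h1, h2, h3⟩ := hpr (m + s) (Submodule.add_mem_sup hm hs)
    have h4 : p (m + s) - m = s - r (m + s) := by
      rw [sub_eq_sub_iff_add_eq_add, h3, add_comm]
    have h5 : p (m + s) - m = 0 := by
      refine (Submodule.disjoint_def.mp hd) _ (M.sub_mem h1 hm) ?_
      rw [h4]; exact S.sub_mem hs h2
    exact ⟨sub_eq_zero.mp h5, (sub_eq_zero.mp (h4 ▸ h5)).symm⟩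
  have hQ : ∀ m ∈ M, ∀ s ∈ S,
      P (p (m + s)) + R (r (m + s)) + B (p (m + s)) (r (m + s)) = P m + R s + B m s := by
    intro m hm s hs
    rw [(key m hm s hs).1, (key m hm s hs).2]
  refine ⟨fun v => P (p v) + R (r v) + B (p v) (r v), ?_, ?_, ?_, ?_⟩
  · intro n v hv
    obtain ⟨m, hm, s, hs, rfl⟩ := Submodule.mem_sup.mp hv
    rw [map_add]
    exact Submodule.add_mem_sup (hP.subrep n m hm) (hR.subrep n s hs)
  · intro a v hv
    obtain ⟨m, hm, s, hs, rfl⟩ := Submodule.mem_sup.mp hv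
    rw [smul_add, hQ _ (M.smul_mem a hm) _ (S.smul_mem a hs), hQ m hm s hs, hP.smul a m hm,
      hR.smul a s hs]
    simp only [map_smul, LinearMap.smul_apply, smul_eq_mul]
    ring
  · intro v hv w hw
    obtain ⟨m, hm, s, hs, rfl⟩ := Submodule.mem_sup.mp hv
    obtain ⟨m', hm', s', hs', rfl⟩ := Submodule.mem_sup.mp hw
    rw [add_add_add_comm, hQ _ (M.add_mem hm hm') _ (S.add_mem hs hs'), hQ m hm s hs,
      hQ m' hm' s' hs', hP.add m hm m' hm', hR.add s hs s' hs']
    simp only [map_add, LinearMap.add_apply]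
    rw [hsym s m']
    ring
  · intro n v hv
    obtain ⟨m, hm, s, hs, rfl⟩ := Submodule.mem_sup.mp hv
    rw [map_add, hQ _ (hP.subrep n m hm) _ (hR.subrep n s hs), hQ m hm s hs, hP.inv n m hm,
      hR.inv n s hs, hB]

lemma exists_isQuadOn_of_irred [FiniteDimensional F V] (hs : IsSplitting F N)
    (hN : AllQuadType F N) {ρ : Representation F N V} (hfix : ∀ v, (∀ n, ρ n v = v) → v = 0)
    {B : V →ₗ[F] V →ₗ[F] F} (hB : BilinInvariant ρ B)
    {S : Submodule F V} (hS : IsSubrep ρ S) (hirr : IsIrred (subRep ρ S hS)) :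
    ∃ Q, IsQuadOn ρ B S Q := by
  let C : S →ₗ[F] S →ₗ[F] F := B.compl₁₂ S.subtype S.subtype
  have hC : BilinInvariant (subRep ρ S hS) C := fun n v w => hB n v w
  suffices h : ∃ Q : S → F, PolarizesTo Q C ∧ QuadInvariant (subRep ρ S hS) Q by
    obtain ⟨Q, hQ, hi⟩ := h
    have hext : ∃ R : V → F, ∀ s : S, R s = Q s :=
      ⟨Function.extend (fun s : S => (s : V)) Q 0,
        fun s => Subtype.val_injective.extend_apply Q 0 s⟩
    obtain ⟨R, hR⟩ := hext
    refine ⟨R, hS, fun a v hv => ?_, fun v hv w hw => ?_, fun n v hv => ?_⟩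
    · have := hQ.1 a ⟨v, hv⟩
      rwa [← hR, ← hR] at this
    · have := hQ.2 ⟨v, hv⟩ ⟨w, hw⟩
      rwa [← hR, ← hR, ← hR] at this
    · have := hi n ⟨v, hv⟩
      rwa [← hR, ← hR] at this
  by_cases h0 : C = 0
  · exact ⟨0, ⟨fun a v => by simp, fun v w => by simp [h0]⟩, fun n v => rfl⟩
  have hnd := nondeg_of_ne_zero hirr hC h0
  obtain ⟨Q, C', hQ, hi, hnd'⟩ := hN S (subRep ρ S hS) inferInstance hirr (fun ht => by
    obtain ⟨s, hs0⟩ := (nontrivial_iff_exists_ne (0 : S)).mp hirr.1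
    exact hs0 (Subtype.ext (hfix s fun n => congrArg Subtype.val (ht n s))))
    (isSelfDual_of_form hC hnd)
  obtain ⟨c, hc⟩ := exists_smul_form hs hirr (hQ.bilinInvariant hi) hnd' hC
  exact ⟨fun v => c * Q v, hc ▸ hQ.smul c, fun n v => congrArg (c * ·) (hi n v)⟩

end Extension

section Clifford
variable {F : Type} [Field F] {V : Type} [AddCommGroup V] [Module F V]

lemma exists_subrep_finrank_le [Nontrivial V] {N : Type} [Group N] (ρ : Representation F N V) :
    ∃ S : Submodule F V, S ≠ ⊥ ∧ IsSubrep ρ S ∧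
      ∀ U : Submodule F V, U ≠ ⊥ → IsSubrep ρ U → finrank F S ≤ finrank F U := by
  obtain ⟨S, ⟨h1, h2⟩, h3⟩ := (measure fun U : Submodule F V => finrank F U).wf.has_min
    {U | U ≠ ⊥ ∧ IsSubrep ρ U} ⟨⊤, top_ne_bot, fun _ _ _ => trivial⟩
  exact ⟨S, h1, h2, fun U hU hU' => not_lt.mp (h3 U ⟨hU, hU'⟩)⟩

lemma isIrred_subRep_of_finrank_le [FiniteDimensional F V] {N : Type} [Group N] {ρ : Representation F N V}
    {S : Submodule F V} (hS0 : S ≠ ⊥) (hS : IsSubrep ρ S)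
    (hmin : ∀ U : Submodule F V, U ≠ ⊥ → IsSubrep ρ U → finrank F S ≤ finrank F U) :
    IsIrred (subRep ρ S hS) := by
  refine ⟨Submodule.nontrivial_iff_ne_bot.mpr hS0, fun U hU => ?_⟩
  by_cases h : U = ⊥
  · exact Or.inl h
  right
  have h1 := hmin (U.map S.subtype)
    (fun hb => h (Submodule.map_injective_of_injective S.injective_subtype (hb.trans (Submodule.map_bot _).symm))) (by
      rintro n _ ⟨u, hu, rfl⟩
      exact ⟨_, hU n u hu, rfl⟩)
  rw [Submodule.finrank_map_subtype_eq] at h1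
  exact Submodule.eq_top_of_finrank_eq (le_antisymm (Submodule.finrank_le U) h1)

/-- If every self-dual irreducible representation of a normal subgroup `N` is of quadratic type,
then an invariant symmetric form on an irreducible representation of `G` without `N`-fixed
vectors is the polar form of an `N`-invariant quadratic form. -/
lemma exists_quad_of_normal [FiniteDimensional F V] {G : Type} [Group G] (N : Subgroup G) [N.Normal]
    (hs : IsSplitting F N) (hN : AllQuadType F N) {ρ : Representation F G V}
    (hρ : IsIrred ρ) (hfix : ∀ v, (∀ n : N, ρ n v = v) → v = 0)
    {B : V →ₗ[F] V →ₗ[F] F} (hB : BilinInvariant ρ B) (hsym : ∀ v w, B v w = B w v) :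
    ∃ Q : V → F, PolarizesTo Q B ∧ QuadInvariant (ρ.comp N.subtype) Q := by
  set ρN : Representation F N V := ρ.comp N.subtype with hρN
  have hBN : BilinInvariant ρN B := fun n v w => hB n v w
  obtain ⟨M, ⟨Q, hQ⟩, hM⟩ := (wellFounded_gt (α := Submodule F V)).has_min
    {M | ∃ Q, IsQuadOn ρN B M Q} ⟨⊥, 0, by
      refine ⟨?_, ?_, ?_, ?_⟩
      · rintro n v hv
        rw [(Submodule.mem_bot F).mp hv, map_zero]
        exact Submodule.zero_mem _
      · simp
      · rintro v hv w -
        rw [(Submodule.mem_bot F).mp hv]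
        simp
      · simp⟩
  suffices h : M = ⊤ by
    subst h
    exact ⟨Q, ⟨fun a v => hQ.smul a v trivial, fun v w => hQ.add v trivial w trivial⟩,
      fun n v => hQ.inv n v trivial⟩
  have := hρ.1
  obtain ⟨S₀, hS₀, hsub₀, hmin₀⟩ := exists_subrep_finrank_le ρN
  by_contra hMt
  have hex : ∃ g, ¬ S₀.map (ρ g) ≤ M := by
    by_contra! hall
    have hT : IsSubrep ρ (⨅ g, M.comap (ρ g)) := by
      intro g v hv
      simp only [Submodule.mem_iInf, Submodule.mem_comap] at hv ⊢
      intro h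
      simpa using hv (h * g)
    have hle : S₀ ≤ ⨅ g, M.comap (ρ g) :=
      le_iInf fun g => Submodule.map_le_iff_le_comap.mp (hall g)
    rcases hρ.2 _ hT with h | h
    · exact hS₀ (le_bot_iff.mp (h ▸ hle))
    · refine hMt (top_le_iff.mp (h ▸ (iInf_le _ 1).trans fun v hv => ?_))
      simpa using hv
  obtain ⟨g, hg⟩ := hex
  have hinj : Function.Injective (ρ g) := (ρ.apply_bijective g).1
  have hfr : finrank F (S₀.map (ρ g)) = finrank F S₀ :=
    (Submodule.equivMapOfInjective (ρ g) hinj S₀).finrank_eq.symm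
  have hsub : IsSubrep ρN (S₀.map (ρ g)) := by
    rintro n _ ⟨s, hs', rfl⟩
    refine ⟨_, hsub₀ ⟨g⁻¹ * n * g, by
      simpa using ‹N.Normal›.conj_mem n n.2 g⁻¹⟩ s hs', ?_⟩
    simp [hρN]
  have hne : S₀.map (ρ g) ≠ ⊥ := fun hb =>
    hS₀ (Submodule.map_injective_of_injective hinj (hb.trans (Submodule.map_bot _).symm))
  have hmin : ∀ U : Submodule F V, U ≠ ⊥ → IsSubrep ρN U →
      finrank F (S₀.map (ρ g)) ≤ finrank F U := fun U h1 h2 => hfr ▸ hmin₀ U h1 h2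
  obtain ⟨R, hR⟩ := exists_isQuadOn_of_irred hs hN hfix hBN hsub
    (isIrred_subRep_of_finrank_le hne hsub hmin)
  have hdisj : Disjoint M (S₀.map (ρ g)) := by
    rw [disjoint_iff]
    by_contra hb
    refine hg (inf_eq_right.mp (Submodule.eq_of_le_of_finrank_le inf_le_right ?_))
    exact hmin _ hb fun n v hv => ⟨hQ.subrep n v hv.1, hsub n v hv.2⟩
  refine hM _ (IsQuadOn.exists_sup hBN hsym hdisj hQ hR) ?_
  exact lt_of_le_of_ne le_sup_left fun h => hg (h ▸ le_sup_right)

lemma hasQuadType_of_normal [CharP F 2] [PerfectField F] [FiniteDimensional F V]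
    {G : Type} [Group G] (N : Subgroup G)
    [N.Normal] (hs : IsSplitting F N) (hsG : IsSplitting F G) (hN : AllQuadType F N)
    {ρ : Representation F G V} (hρ : IsIrred ρ) (hsd : IsSelfDual ρ)
    (hfix : ∀ v, (∀ n : N, ρ n v = v) → v = 0) : HasQuadType ρ := by
  obtain ⟨B, hB, hnd⟩ := exists_form_of_isSelfDual hsd
  obtain ⟨Q, hQ, hi⟩ := exists_quad_of_normal N hs hN hρ hfix hB (hB.flip_eq hsG hρ hnd)
  refine ⟨Q, B, hQ, fun g v => ?_, hnd⟩
  obtain ⟨l, hl⟩ := exists_linear_sq_eq (fun v => Q (ρ g v) - Q v)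
    (fun v w => by
      rw [map_add, hQ.2, hQ.2, hB]; ring)
    (fun a v => by rw [map_smul, hQ.1, hQ.1]; ring)
  have hln : ∀ (n : N) v, l (ρ n v) = l v := by
    intro n v
    have h1 : l (ρ n v) ^ 2 = l v ^ 2 := by
      rw [hl, hl]
      have h2 : ρ g (ρ n v) = ρ (g * n * g⁻¹) (ρ g v) := by simp
      have h3 := hi ⟨g * n * g⁻¹, ‹N.Normal›.conj_mem n n.2 g⟩ (ρ g v)
      have h4 := hi n v
      simp only [MonoidHom.comp_apply, Subgroup.subtype_apply] at h3 h4
      rw [h2, h3, h4]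
    exact frobenius_inj F 2 h1
  obtain ⟨u, hu⟩ := hnd.bijective.2 l
  have hu0 : u = 0 := hfix u fun n => by
    apply hnd.bijective.1
    ext w
    have h1 := hB n u (ρ (n : G)⁻¹ w)
    rw [Representation.self_inv_apply] at h1
    rw [h1, hu]
    simpa using hln n⁻¹ w
  have h1 := hl v
  rw [← hu, hu0] at h1
  simpa [sub_eq_zero, eq_comm (a := (0 : F))] using h1

/-- An irreducible representation on which the normal subgroup `N` has a nonzero fixed vector
is inflated from the quotient. -/
lemma fixed_of_exists_fixed {G : Type} [Group G] (N : Subgroup G) [N.Normal]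
    {ρ : Representation F G V} (hρ : IsIrred ρ) {v : V} (hv : v ≠ 0)
    (hfix : ∀ n : N, ρ n v = v) (n : N) : ρ n = 1 := by
  let U : Submodule F V := ⨅ n : N, LinearMap.eqLocus (ρ n) LinearMap.id
  have hmem : ∀ u, u ∈ U ↔ ∀ n : N, ρ n u = u := fun u => by simp [U]
  rcases hρ.2 U (fun g u hu => by
    rw [hmem] at hu ⊢
    intro n
    have h1 := hu ⟨g⁻¹ * n * g, by simpa using ‹N.Normal›.conj_mem n n.2 g⁻¹⟩
    have h2 : ρ n (ρ g u) = ρ g (ρ (g⁻¹ * n * g) u) := by simp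
    rw [h2, h1]) with h | h
  · exact absurd ((Submodule.mem_bot F).mp (h ▸ (hmem v).mpr hfix)) hv
  · ext u
    exact (hmem u).mp (h ▸ Submodule.mem_top) n

lemma allQuadType_of_normal [CharP F 2] [PerfectField F] {G : Type} [Group G] (N : Subgroup G)
    [N.Normal] (hs : IsSplitting F N) (hsG : IsSplitting F G) (hN : AllQuadType F N)
    (hQ : AllQuadType F (G ⧸ N)) : AllQuadType F G := by
  intro V _ _ ρ _ hρ hnt hsd
  by_cases hfix : ∀ v, (∀ n : N, ρ n v = v) → v = 0
  · exact hasQuadType_of_normal N hs hsG hN hρ hsd hfix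
  push Not at hfix
  obtain ⟨v, hv, hv0⟩ := hfix
  let σ : Representation F (G ⧸ N) V :=
    QuotientGroup.lift N ρ fun n hn => fixed_of_exists_fixed N hρ hv0 hv ⟨n, hn⟩
  have hσ : ∀ g : G, σ g = ρ g := fun g => rfl
  obtain ⟨B, hB, hnd⟩ := exists_form_of_isSelfDual hsd
  obtain ⟨Q, C, h1, h2, h3⟩ := hQ V σ inferInstance ⟨hρ.1, fun U hU => hρ.2 U fun g => hU g⟩
    (fun ht => hnt fun g => ht g)
    (isSelfDual_of_form (B := B) (fun g => QuotientGroup.induction_on g hB) hnd)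
  exact ⟨Q, C, h1, fun g => h2 g, h3⟩

lemma AllQuadType.quotient {G : Type} [Group G] (N : Subgroup G) [N.Normal]
    (hG : AllQuadType F G) : AllQuadType F (G ⧸ N) := by
  intro V _ _ ρ _ hρ hnt hsd
  obtain ⟨e, he⟩ := hsd
  obtain ⟨Q, C, h1, h2, h3⟩ := hG V (ρ.comp (QuotientGroup.mk' N)) inferInstance
    ⟨hρ.1, fun U hU => hρ.2 U fun g => QuotientGroup.induction_on g hU⟩
    (fun ht => hnt fun g => QuotientGroup.induction_on g ht) ⟨e, fun g v => he g v⟩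
  exact ⟨Q, C, h1, fun g => QuotientGroup.induction_on g h2, h3⟩

end Clifford

section Stabilizer
variable {F : Type} [Field F] {G : Type} [Group G] {N : Subgroup G} [N.Normal]
variable {W : Type} [AddCommGroup W] [Module F W]

/-- `ψ` is an isometry of `B` that intertwines `σ` with its conjugate by `g`. -/
structure IsIsometricLift (σ : Representation F N W) (B : W →ₗ[F] W →ₗ[F] F) (g : G)
    (ψ : W →ₗ[F] W) : Prop where
  isom : ∀ v w, B (ψ v) (ψ w) = B v w
  comm : ∀ n v, ψ (σ n v) = σ (MulAut.conjNormal g n) (ψ v)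

variable {σ : Representation F N W} {B : W →ₗ[F] W →ₗ[F] F}

namespace IsIsometricLift

lemma one : IsIsometricLift σ B 1 LinearMap.id := ⟨fun _ _ => rfl, fun n v => by simp⟩

lemma mul {g h : G} {ψ χ : W →ₗ[F] W} (hψ : IsIsometricLift σ B g ψ)
    (hχ : IsIsometricLift σ B h χ) : IsIsometricLift σ B (g * h) (ψ ∘ₗ χ) :=
  ⟨fun v w => by simp [hψ.isom, hχ.isom], fun n v => by simp [hψ.comm, hχ.comm]⟩

lemma of_mem (hB : BilinInvariant σ B) (n : N) : IsIsometricLift σ B (n : G) (σ n) := by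
  refine ⟨hB n, fun m v => ?_⟩
  have h : MulAut.conjNormal (n : G) m = n * m * n⁻¹ := Subtype.ext (by simp)
  simp [h]

lemma injective (hn : Nondeg B) {g : G} {ψ : W →ₗ[F] W} (hψ : IsIsometricLift σ B g ψ) :
    Function.Injective ψ := by
  rw [injective_iff_map_eq_zero]
  intro v hv
  refine hn v fun w => ?_
  rw [← hψ.isom, hv]
  simp

lemma exists_inv [FiniteDimensional F W] (hn : Nondeg B) {g : G} {ψ : W →ₗ[F] W}
    (hψ : IsIsometricLift σ B g ψ) :
    ∃ χ, IsIsometricLift σ B g⁻¹ χ ∧ ∀ v, ψ (χ v) = v := by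
  let e := LinearEquiv.ofInjectiveEndo ψ (hψ.injective hn)
  have he : ∀ v, ψ (e.symm v) = v := fun v => e.apply_symm_apply v
  refine ⟨e.symm.toLinearMap, ⟨fun v w => ?_, fun n v => ?_⟩, he⟩
  · rw [← hψ.isom]
    simp [he]
  · apply hψ.injective hn
    rw [hψ.comm]
    simp [he]

/-- In characteristic two the isometric lift of an element is unique. -/
lemma unique [CharP F 2] [FiniteDimensional F W] (hs : IsSplitting F N) (hσ : IsIrred σ)
    (hn : Nondeg B) {g : G} {ψ χ : W →ₗ[F] W} (hψ : IsIsometricLift σ B g ψ)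
    (hχ : IsIsometricLift σ B g χ) : ψ = χ := by
  obtain ⟨θ, hθ, hinv⟩ := hψ.exists_inv hn
  have h1 := hθ.mul hχ
  rw [inv_mul_cancel] at h1
  obtain ⟨c, hc⟩ := hs W σ inferInstance hσ (θ ∘ₗ χ) fun n v => by
    simpa using h1.comm n v
  have := hσ.1
  obtain ⟨v, hv⟩ := exists_ne (0 : W)
  obtain ⟨w, hw⟩ : ∃ w, B v w ≠ 0 := by
    by_contra! h
    exact hv (hn v h)
  have h2 := h1.isom v w
  rw [hc] at h2
  simp only [LinearMap.smul_apply, LinearMap.id_apply, map_smul, smul_eq_mul] at h2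
  have h3 : c ^ 2 = 1 ^ 2 := by
    apply mul_right_cancel₀ hw
    linear_combination h2
  have h4 : c = 1 := frobenius_inj F 2 h3
  ext u
  have h5 := LinearMap.congr_fun hc u
  rw [h4] at h5
  have h6 := congrArg ψ h5
  simpa [hinv] using h6.symm

/-- Over a perfect field of characteristic two, every intertwiner can be rescaled to an
isometry. -/
lemma exists_of_injective [CharP F 2] [PerfectField F] [FiniteDimensional F W]
    (hs : IsSplitting F N) (hσ : IsIrred σ) (hB : BilinInvariant σ B) (hn : Nondeg B)
    {g : G} {ψ : W →ₗ[F] W} (hψ : Function.Injective ψ)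
    (hcomm : ∀ n v, ψ (σ n v) = σ (MulAut.conjNormal g n) (ψ v)) :
    ∃ χ, IsIsometricLift σ B g χ := by
  obtain ⟨a, ha⟩ := exists_smul_form hs hσ hB hn (C := B.compl₁₂ ψ ψ) fun n v w => by
    simp only [LinearMap.compl₁₂_apply, hcomm]
    exact hB _ _ _
  have ha' : ∀ v w, B (ψ v) (ψ w) = a * B v w := fun v w => by
    simpa using LinearMap.congr_fun (LinearMap.congr_fun ha v) w
  have ha0 : a ≠ 0 := by
    rintro rfl
    have := hσ.1
    obtain ⟨v, hv⟩ := exists_ne (0 : W)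
    refine hv ((injective_iff_map_eq_zero ψ).mp hψ v (hn _ fun w => ?_))
    obtain ⟨u, rfl⟩ := LinearMap.injective_iff_surjective.mp hψ w
    rw [ha', zero_mul]
  obtain ⟨d, rfl⟩ := exists_sq_eq a
  have hd : d ≠ 0 := fun h => ha0 (by simp [h])
  refine ⟨d⁻¹ • ψ, fun v w => ?_, fun n v => by simp [hcomm]⟩
  simp only [LinearMap.smul_apply, map_smul, smul_eq_mul, ha']
  field_simp

end IsIsometricLift

/-- In characteristic two, a self-dual irreducible representation of a normal subgroup extends,
together with its invariant form, to its inertia group. -/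
lemma exists_extension_to_inertia [CharP F 2] [PerfectField F] [FiniteDimensional F W]
    (hs : IsSplitting F N) (hσ : IsIrred σ) (hB : BilinInvariant σ B) (hn : Nondeg B) :
    ∃ (S : Subgroup G) (hNS : N ≤ S) (φ : Representation F S W),
      (∀ n, φ (Subgroup.inclusion hNS n) = σ n) ∧ BilinInvariant φ B ∧
      ∀ (g : G) (ψ : W →ₗ[F] W), Function.Injective ψ →
        (∀ n v, ψ (σ n v) = σ (MulAut.conjNormal g n) (ψ v)) → g ∈ S := by
  let S : Subgroup G :=
    { carrier := {g | ∃ ψ, IsIsometricLift σ B g ψ}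
      one_mem' := ⟨_, .one⟩
      mul_mem' := fun ⟨_, h⟩ ⟨_, h'⟩ => ⟨_, h.mul h'⟩
      inv_mem' := fun ⟨_, h⟩ => (h.exists_inv hn).imp fun _ h => h.1 }
  have hS : ∀ s : S, ∃ ψ, IsIsometricLift σ B (s : G) ψ := fun s => s.2
  choose f hf using hS
  exact ⟨S, fun n hnN => ⟨_, .of_mem hB ⟨n, hnN⟩⟩,
    { toFun := f
      map_one' := (hf 1).unique hs hσ hn .one
      map_mul' := fun s t => (hf (s * t)).unique hs hσ hn ((hf s).mul (hf t)) },
    fun n => (hf _).unique hs hσ hn (.of_mem hB n), fun s => (hf s).isom,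
    fun g ψ hi hc => IsIsometricLift.exists_of_injective hs hσ hB hn hi hc⟩

end Stabilizer

section Coinduction
variable {F : Type} [Field F] {G : Type} [Group G] {S : Subgroup G}
variable {W : Type} [AddCommGroup W] [Module F W]

open Representation

lemma coindV_apply_mul {φ : Representation F S W} (f : coindV S.subtype φ) {s : G} (hs : s ∈ S)
    (g : G) : f.1 (s * g) = φ ⟨s, hs⟩ (f.1 g) := f.2 ⟨s, hs⟩ g

lemma coind_apply_apply (φ : Representation F S W) (h g : G) (f : coindV S.subtype φ) :
    (coind S.subtype φ h f).1 g = f.1 (g * h) := rfl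

open scoped Classical in
/-- The embedding of `φ` in its coinduction as the functions supported on `S`. -/
noncomputable def coindSingle (φ : Representation F S W) : W →ₗ[F] coindV S.subtype φ where
  toFun w := ⟨fun g => if h : g ∈ S then φ ⟨g, h⟩ w else 0, by
    intro s g
    by_cases hg : g ∈ S
    · have h : S.subtype s * g ∈ S := S.mul_mem s.2 hg
      have h' : (⟨S.subtype s * g, h⟩ : S) = s * ⟨g, hg⟩ := rfl
      simp only [dif_pos hg, dif_pos h]
      rw [h', map_mul]
      rfl
    · have h : S.subtype s * g ∉ S := fun h => hg ((S.mul_mem_cancel_left s.2).mp h)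
      simp only [dif_neg hg, dif_neg h, map_zero]⟩
  map_add' v w := by
    ext g
    by_cases hg : g ∈ S <;> simp [hg]
  map_smul' a w := by
    ext g
    by_cases hg : g ∈ S <;> simp [hg]

lemma coindSingle_of_mem (φ : Representation F S W) (w : W) {g : G} (hg : g ∈ S) :
    (coindSingle φ w).1 g = φ ⟨g, hg⟩ w := dif_pos hg

lemma coindSingle_of_notMem (φ : Representation F S W) (w : W) {g : G} (hg : g ∉ S) :
    (coindSingle φ w).1 g = 0 := dif_neg hg

lemma coindSingle_one (φ : Representation F S W) (w : W) : (coindSingle φ w).1 1 = w := by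
  rw [coindSingle_of_mem φ w S.one_mem]
  exact LinearMap.congr_fun (map_one φ) w

lemma eq_coindSingle {φ : Representation F S W} (f : coindV S.subtype φ)
    (hf : ∀ g ∉ S, f.1 g = 0) : f = coindSingle φ (f.1 1) := by
  ext g
  by_cases hg : g ∈ S
  · rw [coindSingle_of_mem φ _ hg, ← coindV_apply_mul f hg, mul_one]
  · rw [coindSingle_of_notMem φ _ hg, hf g hg]

lemma coind_coindSingle (φ : Representation F S W) (s : S) (w : W) :
    coind S.subtype φ s (coindSingle φ w) = coindSingle φ (φ s w) := by
  rw [eq_coindSingle (coind S.subtype φ s (coindSingle φ w)) fun g hg => ?_]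
  · rw [coind_apply_apply, one_mul, coindSingle_of_mem φ w s.2]
  · rw [coind_apply_apply, coindSingle_of_notMem]
    exact fun h => hg ((S.mul_mem_cancel_right s.2).mp h)

lemma rightRel_out_mul_inv_mem (S : Subgroup G) (g : G) :
    g * (Quotient.out (Quotient.mk (QuotientGroup.rightRel S) g))⁻¹ ∈ S :=
  QuotientGroup.rightRel_apply.mp (Quotient.mk_out (s := QuotientGroup.rightRel S) g)

lemma eq_mk_of_mul_inv_out_mem {S : Subgroup G} {g : G}
    {q : Quotient (QuotientGroup.rightRel S)} (h : g * q.out⁻¹ ∈ S) :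
    q = Quotient.mk (QuotientGroup.rightRel S) g := by
  rw [← q.out_eq]
  exact Quotient.sound (s := QuotientGroup.rightRel S) (QuotientGroup.rightRel_apply.mpr h)

/-- The translates of the functions supported on `S` span the coinduced representation. -/
lemma eq_top_of_coindSingle_mem [Finite G] {φ : Representation F S W}
    {U : Submodule F (coindV S.subtype φ)} (hU : IsSubrep (coind S.subtype φ) U)
    (h : ∀ w, coindSingle φ w ∈ U) : U = ⊤ := by
  have := Fintype.ofFinite (Quotient (QuotientGroup.rightRel S))
  refine eq_top_iff.mpr fun f _ => ?_
  have hf : f = ∑ q : Quotient (QuotientGroup.rightRel S),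
      coind S.subtype φ q.out⁻¹ (coindSingle φ (f.1 q.out)) := by
    ext g
    rw [AddSubmonoidClass.coe_finsetSum, Finset.sum_apply,
      Finset.sum_eq_single (Quotient.mk (QuotientGroup.rightRel S) g)]
    · have hg := rightRel_out_mul_inv_mem S g
      rw [coind_apply_apply, coindSingle_of_mem φ _ hg, ← coindV_apply_mul f hg,
        inv_mul_cancel_right]
    · intro q _ hq
      rw [coind_apply_apply, coindSingle_of_notMem]
      exact fun h => hq (eq_mk_of_mul_inv_out_mem h)
    · simp
  rw [hf]
  exact U.sum_mem fun q _ => hU _ _ (h _)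

/-- An invariant form on `φ` induces one on the coinduced representation. -/
lemma exists_coind_form [Finite G] {φ : Representation F S W} {B : W →ₗ[F] W →ₗ[F] F}
    (hB : BilinInvariant φ B) : ∃ C : coindV S.subtype φ →ₗ[F] coindV S.subtype φ →ₗ[F] F,
      BilinInvariant (coind S.subtype φ) C ∧
      ∀ v w, C (coindSingle φ v) (coindSingle φ w) = B v w := by
  have := Fintype.ofFinite (Quotient (QuotientGroup.rightRel S))
  let ev (g : G) : coindV S.subtype φ →ₗ[F] W := LinearMap.proj g ∘ₗ Submodule.subtype _
  let C : coindV S.subtype φ →ₗ[F] coindV S.subtype φ →ₗ[F] F :=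
    ∑ q : Quotient (QuotientGroup.rightRel S), B.compl₁₂ (ev q.out) (ev q.out)
  have hC : ∀ f f', C f f' =
      ∑ q : Quotient (QuotientGroup.rightRel S), B (f.1 q.out) (f'.1 q.out) := by
    intro f f'
    simp only [C, LinearMap.sum_apply]
    rfl
  have hconst : ∀ (f f' : coindV S.subtype φ) (a b : G), b * a⁻¹ ∈ S →
      B (f.1 b) (f'.1 b) = B (f.1 a) (f'.1 a) := by
    intro f f' a b hab
    have h := fun f : coindV S.subtype φ => coindV_apply_mul f hab a
    simp only [inv_mul_cancel_right] at h
    rw [h, h, hB]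
  refine ⟨C, fun g f f' => ?_, fun v w => ?_⟩
  · rw [hC, hC]
    let t (q : Quotient (QuotientGroup.rightRel S)) : Quotient (QuotientGroup.rightRel S) :=
      Quotient.mk _ (q.out * g)
    have ht : Function.Injective t := by
      intro q q' h
      have h1 := QuotientGroup.rightRel_apply.mp (Quotient.exact h)
      have h2 : q = Quotient.mk _ q'.out := eq_mk_of_mul_inv_out_mem (by simpa using h1)
      rw [h2, Quotient.out_eq]
    refine Eq.trans ?_ ((Finite.injective_iff_bijective.mp ht).sum_comp fun q =>
      B (f.1 q.out) (f'.1 q.out))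
    refine Finset.sum_congr rfl fun q _ => ?_
    rw [coind_apply_apply, coind_apply_apply]
    exact hconst f f' _ _ (rightRel_out_mul_inv_mem S _)
  · rw [hC, Finset.sum_eq_single (Quotient.mk (QuotientGroup.rightRel S) 1)]
    · rw [← hconst _ _ _ _ (rightRel_out_mul_inv_mem S 1), coindSingle_one, coindSingle_one]
    · intro q _ hq
      rw [coindSingle_of_notMem φ v fun h => hq (eq_mk_of_mul_inv_out_mem (by simpa using h))]
      simp
    · simp

variable {N : Subgroup G} [N.Normal]

lemma coind_normal_apply (hNS : N ≤ S) {φ : Representation F S W} {σ : Representation F N W}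
    (hφ : ∀ n, φ (Subgroup.inclusion hNS n) = σ n) (n : N) (f : coindV S.subtype φ) (g : G) :
    (coind S.subtype φ n f).1 g = σ (MulAut.conjNormal g n) (f.1 g) := by
  rw [coind_apply_apply, ← hφ]
  have h : g * n = MulAut.conjNormal g n * g := by
    rw [MulAut.conjNormal_apply, inv_mul_cancel_right]
  rw [h]
  exact coindV_apply_mul f (hNS (MulAut.conjNormal g n).2) g

/-- Clifford correspondence: coinduction from the inertia group preserves irreducibility. -/
lemma isIrred_coind [Finite G] (hNS : N ≤ S) {φ : Representation F S W}
    {σ : Representation F N W} (hσ : IsIrred σ) (hφ : ∀ n, φ (Subgroup.inclusion hNS n) = σ n)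
    (hin : ∀ (g : G) (ψ : W →ₗ[F] W), Function.Injective ψ →
      (∀ n v, ψ (σ n v) = σ (MulAut.conjNormal g n) (ψ v)) → g ∈ S) :
    IsIrred (coind S.subtype φ) := by
  have := hσ.1
  have hinj : Function.Injective (coindSingle φ) := fun v w h => by
    rw [← coindSingle_one φ v, h, coindSingle_one]
  refine ⟨hinj.nontrivial, fun U hU => or_iff_not_imp_left.mpr fun hU0 => ?_⟩
  obtain ⟨f₀, hf₀, hf₀'⟩ := U.exists_mem_ne_zero_of_ne_bot hU0
  obtain ⟨f, ⟨hfU, hf0⟩, hmin⟩ :=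
    (measure fun f : coindV S.subtype φ => (Function.support f.1).ncard).wf.has_min
      {f | f ∈ U ∧ f ≠ 0} ⟨f₀, hf₀, hf₀'⟩
  let U' : Submodule F (coindV S.subtype φ) :=
    { carrier := {f' | f' ∈ U ∧ ∀ y, f.1 y = 0 → f'.1 y = 0}
      zero_mem' := ⟨U.zero_mem, fun _ _ => rfl⟩
      add_mem' := fun h h' => ⟨U.add_mem h.1 h'.1, fun y hy => by simp [h.2 y hy, h'.2 y hy]⟩
      smul_mem' := fun a _ h => ⟨U.smul_mem a h.1, fun y hy => by simp [h.2 y hy]⟩ }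
  have hU'N : ∀ (n : N) (u : coindV S.subtype φ), u ∈ U' → coind S.subtype φ n u ∈ U' :=
    fun n u hu => ⟨hU n u hu.1, fun y hy => by
      rw [coind_normal_apply hNS hφ, hu.2 y hy, map_zero]⟩
  let ev (y : G) : U' →ₗ[F] W :=
    LinearMap.proj y ∘ₗ (coindV S.subtype φ).subtype ∘ₗ U'.subtype
  have hev : ∀ y, f.1 y ≠ 0 → Function.Bijective (ev y) := by
    intro y hy
    constructor
    · rw [injective_iff_map_eq_zero]
      rintro ⟨u, hu⟩ (huy : u.1 y = 0)
      by_contra hne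
      refine hmin u ⟨hu.1, fun h => hne (Subtype.ext h)⟩ (Set.ncard_lt_ncard ?_ (Set.toFinite _))
      have hsub : Function.support u.1 ⊆ Function.support f.1 := fun z hz h => hz (hu.2 z h)
      exact (Set.ssubset_iff_of_subset hsub).mpr ⟨y, hy, fun h => h huy⟩
    · rw [← LinearMap.range_eq_top]
      refine (hσ.2 _ ?_).resolve_left fun h => hy ?_
      · rintro n _ ⟨u, rfl⟩
        refine ⟨⟨_, hU'N (MulAut.conjNormal y⁻¹ n) u u.2⟩, ?_⟩
        refine (coind_normal_apply hNS hφ _ _ _).trans ?_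
        rw [← MulAut.mul_apply, ← map_mul, mul_inv_cancel, map_one]
        rfl
      · have : f.1 y ∈ LinearMap.range (ev y) := ⟨⟨f, hfU, fun _ h => h⟩, rfl⟩
        rwa [h, Submodule.mem_bot] at this
  obtain ⟨x, hx⟩ : ∃ x, f.1 x ≠ 0 := by
    by_contra! h
    exact hf0 (Subtype.ext (funext h))
  have hsupp : ∀ g, f.1 g ≠ 0 → g * x⁻¹ ∈ S := by
    intro g hg
    let ex := LinearEquiv.ofBijective (ev x) (hev x hx)
    refine hin _ (ev g ∘ₗ ex.symm.toLinearMap) ((hev g hg).1.comp ex.symm.injective) fun n v => ?_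
    obtain ⟨u, rfl⟩ := ex.surjective v
    have h1 : σ n (ex u) = ex ⟨_, hU'N (MulAut.conjNormal x⁻¹ n) u u.2⟩ := by
      refine Eq.trans ?_ (coind_normal_apply hNS hφ _ _ _).symm
      rw [← MulAut.mul_apply, ← map_mul, mul_inv_cancel, map_one]
      rfl
    rw [h1]
    simp only [LinearMap.comp_apply, LinearEquiv.coe_coe, LinearEquiv.symm_apply_apply]
    refine (coind_normal_apply hNS hφ _ _ _).trans ?_
    rw [← MulAut.mul_apply, ← map_mul]
    rfl
  have hmem : coindSingle φ (f.1 x) ∈ U := by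
    have h := eq_coindSingle (coind S.subtype φ x f) fun g hg => by
      by_contra h
      exact hg (by simpa using hsupp _ h)
    rw [coind_apply_apply, one_mul] at h
    rw [← h]
    exact hU x f hfU
  refine eq_top_of_coindSingle_mem hU fun w => ?_
  have hT : U.comap (coindSingle φ) = ⊤ := by
    refine (hσ.2 _ fun n w hw => ?_).resolve_left fun h => hx ?_
    · have h := hU n _ hw
      have h2 := coind_coindSingle φ (Subgroup.inclusion hNS n) w
      rw [hφ] at h2
      rw [Submodule.mem_comap, ← h2]
      exact h
    · rwa [← Submodule.mem_bot (R := F), ← h]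
  exact (hT ▸ Submodule.mem_top : w ∈ U.comap (coindSingle φ))

end Coinduction

lemma AllQuadType.subgroup {F : Type} [Field F] [CharP F 2] [PerfectField F]
    {G : Type} [Group G] [Finite G] {N : Subgroup G} [N.Normal] (hs : IsSplitting F N)
    (hsG : IsSplitting F G) (hG : AllQuadType F G) : AllQuadType F N := by
  intro W _ _ σ _ hσ hnt hsd
  obtain ⟨B, hB, hn⟩ := exists_form_of_isSelfDual hsd
  obtain ⟨S, hNS, φ, hφ, hφB, hin⟩ := exists_extension_to_inertia hs hσ hB hn
  have hirr := isIrred_coind hNS hσ hφ hin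
  obtain ⟨C, hC, hCB⟩ := exists_coind_form hφB
  have hact : ∀ (n : N) w, Representation.coind S.subtype φ n (coindSingle φ w) =
      coindSingle φ (σ n w) := fun n w => by
    rw [← hφ]
    exact coind_coindSingle φ (Subgroup.inclusion hNS n) w
  have hC0 : C ≠ 0 := by
    rintro rfl
    have := hσ.1
    obtain ⟨v, hv⟩ := exists_ne (0 : W)
    exact hv (hn v fun w => by rw [← hCB]; rfl)
  have hCn := nondeg_of_ne_zero hirr hC hC0
  obtain ⟨Q, D, hQ, hi, hD⟩ := hG _ (Representation.coind S.subtype φ) inferInstance hirr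
    (fun ht => hnt fun n w => by
      rw [← coindSingle_one φ (σ n w), ← hact, ht, coindSingle_one])
    (isSelfDual_of_form hC hCn)
  obtain ⟨c, hc⟩ := exists_smul_form hsG hirr (hQ.bilinInvariant hi) hD hC
  have hc' : ∀ v w, B v w = c * D (coindSingle φ v) (coindSingle φ w) := fun v w => by
    rw [← hCB, hc]
    rfl
  refine ⟨fun w => Q (coindSingle φ w), D.compl₁₂ (coindSingle φ) (coindSingle φ),
    ⟨fun a w => ?_, fun v w => ?_⟩, fun n w => ?_, fun v hv => hn v fun w => ?_⟩
  · dsimp only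
    rw [map_smul, hQ.1]
  · dsimp only
    rw [map_add, hQ.2]
    rfl
  · dsimp only
    rw [← hact, hi]
  · rw [hc', ← LinearMap.compl₁₂_apply, hv, mul_zero]

/-- all nontrivial self-dual irreducible FG-modules are of quadratic type iff the
same is true for both N and G/N. -/
theorem stmt_15 {F : Type} [Field F] [CharP F 2] [PerfectField F]
    {G : Type} [Group G] [Finite G] (N : Subgroup G) [N.Normal]
    (hsplit : ∀ H : Subgroup G, IsSplitting F ↥H) :
    AllQuadType F G ↔ (AllQuadType F ↥N ∧ AllQuadType F (G ⧸ N)) := by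
  have hs := hsplit N
  have hsG : IsSplitting F G := (hsplit ⊤).of_mulEquiv Subgroup.topEquiv
  exact ⟨fun h => ⟨h.subgroup hs hsG, h.quotient N⟩,
    fun h => allQuadType_of_normal N hs hsG h.1 h.2⟩
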